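/- Let N={1,2,3,4,5,6}, let v=u_{{1,2,3}} be the unanimity game (v(S)=1 if {1,2,3}⊆S and v(S)=0 otherwise), and let H={{1,4},{2,5},{3,6},{4,5,6}}. Then the position value of (N,v,H) is π_1=π_2=π_3=1/8 and π_4=π_5=π_6=5/24, while π_i(N,v,A)=0 for all i∈N and every proper subset A⊊H of hyperlinks. -/

import Mathlib

open scoped Classical
open Finset

noncomputable section

namespace HGGame

/-! ## Generic hypergraph notions -/

variable {α : Type*}

/-- Two nodes are linked if they lie in a common hyperlink of `E`. -/
def Linked (E : Finset (Finset α)) (a b : α) : Prop :=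
  ∃ e ∈ E, a ∈ e ∧ b ∈ e

/-- The component of `i` in the subhypergraph of `(α, E)` induced by the ground set `S`
(only hyperlinks contained in `S` count). -/
def compOf (E : Finset (Finset α)) (S : Finset α) (i : α) : Finset α :=
  S.filter (fun j => Relation.ReflTransGen (Linked (E.filter (fun e => e ⊆ S))) i j)

/-- The set `S/E` of components of the subhypergraph induced by `S`. -/
def components (E : Finset (Finset α)) (S : Finset α) : Finset (Finset α) :=
  S.image (compOf E S)

/-- The hypergraph-restricted worth `v^E(S) = Σ_{T ∈ S/E} v(T)`. -/
def restrictedWorth (v : Finset α → ℝ) (E : Finset (Finset α)) (S : Finset α) : ℝ :=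
  ∑ T ∈ components E S, v T

/-! ## Shapley value -/

/-- The set `σ^i` of players preceding `i` in the ordering `σ`. -/
def preceding {M : Type*} [Fintype M] (σ : M ≃ Fin (Fintype.card M)) (i : M) : Finset M :=
  Finset.univ.filter (fun j => σ j < σ i)

/-- The marginal contribution `m^σ_i(u) = u(σ^i ∪ {i}) - u(σ^i)`. -/
def marginal {M : Type*} [Fintype M] (u : Finset M → ℝ) (σ : M ≃ Fin (Fintype.card M))
    (i : M) : ℝ :=
  u (insert i (preceding σ i)) - u (preceding σ i)

/-- The Shapley value of the TU-game `(M, u)`. -/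
def shapley {M : Type*} [Fintype M] (u : Finset M → ℝ) (i : M) : ℝ :=
  ((Fintype.card M).factorial : ℝ)⁻¹ * ∑ σ : M ≃ Fin (Fintype.card M), marginal u σ i

/-- The Harsanyi dividend `λ_T(u) = Σ_{∅ ≠ S ⊆ T} (-1)^{|T|-|S|} u(S)`. -/
def dividend {M : Type*} (u : Finset M → ℝ) (T : Finset M) : ℝ :=
  ∑ S ∈ T.powerset.filter (fun S => S ≠ ∅), (-1 : ℝ) ^ (T.card - S.card) * u S

/-! ## Hypergraph communication situations -/

variable {N : Type*} [Fintype N] [DecidableEq N]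

/-- The conference game `(H, v^N)`, a TU-game with player set `H`:
`v^N(H') = Σ_{T ∈ N/H'} v(T)`. -/
def confGame (v : Finset N → ℝ) (H : Finset (Finset N)) (F : Finset {e // e ∈ H}) : ℝ :=
  restrictedWorth v (F.image Subtype.val) Finset.univ

/-- The position value `π_i(N,v,H) = Σ_{e ∈ H_i} (1/|e|) · Sh_e(H, v^N)`. -/
def positionValue (v : Finset N → ℝ) (H : Finset (Finset N)) (i : N) : ℝ :=
  ∑ e ∈ H.attach.filter (fun e => i ∈ e.val),
    ((e.val.card : ℝ))⁻¹ * shapley (confGame v H) e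

/-! ## The uniform hyperlink game -/

/-- The type of agents `(i, e, k)` of the uniform hyperlink game. -/
abbrev UElem (N : Type*) := N × Finset N × ℕ

/-- `η(H)`: the least common multiple of the hyperlink sizes. -/
def eta (H : Finset (Finset N)) : ℕ := H.lcm Finset.card

/-- `U(H)(i,e) = {(i,e,k) : k = 1, …, η(H)/|e|}`. -/
def UHie (H : Finset (Finset N)) (i : N) (e : Finset N) : Finset (UElem N) :=
  (Finset.Icc 1 (eta H / e.card)).image fun k => (i, e, k)

/-- `U(H)(i) = ∪_{e ∈ H_i} U(H)(i,e)`. -/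
def UHi (H : Finset (Finset N)) (i : N) : Finset (UElem N) :=
  (H.filter (fun e => i ∈ e)).biUnion fun e => UHie H i e

/-- `U(H)(e) = ∪_{i ∈ e} U(H)(i,e)`. -/
def UHe (H : Finset (Finset N)) (e : Finset N) : Finset (UElem N) :=
  e.biUnion fun i => UHie H i e

/-- `U(H) = ∪_{i ∈ N} U(H)(i)`. -/
def UH (H : Finset (Finset N)) : Finset (UElem N) :=
  Finset.univ.biUnion fun i : N => UHi H i

/-- `H[S] = {e ∈ H : U(H)(e) ⊆ S}`. -/
def Hof (H : Finset (Finset N)) (S : Finset (UElem N)) : Finset (Finset N) :=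
  H.filter fun e => UHe H e ⊆ S

/-- The characteristic function `w(S) = Σ_{R ∈ N/H[S]} v(R)` of the uniform hyperlink game. -/
def uw (v : Finset N → ℝ) (H : Finset (Finset N)) (S : Finset (UElem N)) : ℝ :=
  restrictedWorth v (Hof H S) Finset.univ

/-- The uniform hyperlink game `(U(H), w)` as a TU-game with player set `U(H)`. -/
def uGame (v : Finset N → ℝ) (H : Finset (Finset N)) (F : Finset {l // l ∈ UH H}) : ℝ :=
  uw v H (F.image Subtype.val)

/-- The unanimity game `u_{{1,2,3}}` on six players (players `1,…,6` encoded as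
`0,…,5 : Fin 6`). -/
def exV : Finset (Fin 6) → ℝ := fun S => if ({0, 1, 2} : Finset (Fin 6)) ⊆ S then 1 else 0

/-- The hyperlink set `H = {{1,4},{2,5},{3,6},{4,5,6}}` (players shifted down by one). -/
def exH : Finset (Finset (Fin 6)) :=
  {({0, 3} : Finset (Fin 6)), {1, 4}, {2, 5}, {3, 4, 5}}

/-- In the unanimity game of the grand coalition, the marginal contribution of `i` is `1` if `i`
comes last and `0` otherwise. -/
lemma marginal_unanimity_univ {M : Type*} [Fintype M] {u : Finset M → ℝ}
    (hu₁ : u Finset.univ = 1) (hu₀ : ∀ F, F ≠ Finset.univ → u F = 0)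
    (σ : M ≃ Fin (Fintype.card M)) (i : M) :
    marginal u σ i = if ∀ j, σ j ≤ σ i then 1 else 0 := by
  have hpre : preceding σ i ≠ Finset.univ := fun h => by
    have : i ∈ preceding σ i := h ▸ Finset.mem_univ i
    simp [preceding] at this
  have hins : insert i (preceding σ i) = Finset.univ ↔ ∀ j, σ j ≤ σ i := by
    simp only [Finset.eq_univ_iff_forall, Finset.mem_insert, preceding, Finset.mem_filter,
      Finset.mem_univ, true_and, le_iff_eq_or_lt, EmbeddingLike.apply_eq_iff_eq]
  rw [marginal, hu₀ _ hpre, sub_zero]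
  split_ifs with h
  · rw [hins.mpr h, hu₁]
  · exact hu₀ _ (mt hins.mp h)

/-- The unanimity game of the grand coalition is shared equally by the Shapley value. -/
lemma shapley_unanimity_univ {M : Type*} [Fintype M] {u : Finset M → ℝ}
    (hu₁ : u Finset.univ = 1) (hu₀ : ∀ F, F ≠ Finset.univ → u F = 0) (i : M) :
    shapley u i = (Fintype.card M : ℝ)⁻¹ := by
  have : Nonempty M := ⟨i⟩
  set c : M → ℝ := fun k =>
    ∑ σ : M ≃ Fin (Fintype.card M), if ∀ j, σ j ≤ σ k then (1 : ℝ) else 0 with hc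
  have hsymm (k : M) : c k = c i := by
    refine Fintype.sum_equiv (Equiv.equivCongr (Equiv.swap i k) (Equiv.refl _)) _ _ fun σ => ?_
    have : (∀ j, σ j ≤ σ k) ↔ ∀ j, σ (Equiv.swap i k j) ≤ σ k :=
      (Equiv.swap i k).forall_congr_left.trans (by simp)
    simp [this]
  have hsum : ∑ k, c k = (Fintype.card M).factorial := by
    have hlast (σ : M ≃ Fin (Fintype.card M)) :
        ∑ k, (if ∀ j, σ j ≤ σ k then (1 : ℝ) else 0) = 1 := by
      obtain ⟨m, hm⟩ := Finite.exists_max σ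
      rw [Finset.sum_eq_single m, if_pos hm]
      · intro k _ hk
        exact if_neg fun h => hk (σ.injective (le_antisymm (hm k) (h m)))
      · simp
    rw [hc, Finset.sum_comm, Finset.sum_congr rfl fun σ _ => hlast σ]
    simp [Fintype.card_equiv (Fintype.equivFin M)]
  simp only [hsymm, Finset.sum_const, Finset.card_univ, nsmul_eq_mul] at hsum
  have hn : (Fintype.card M : ℝ) ≠ 0 := by simp
  have hf : ((Fintype.card M).factorial : ℝ) ≠ 0 := by positivity
  simp only [shapley, marginal_unanimity_univ hu₁ hu₀]
  change _ * c i = _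
  rw [inv_mul_eq_iff_eq_mul₀ hf, ← hsum]
  field_simp

/-! ## Connectedness in the example -/

lemma mem_components {E : Finset (Finset α)} {S T : Finset α} :
    T ∈ components E S ↔ ∃ i ∈ S, compOf E S i = T :=
  Finset.mem_image

lemma mem_compOf_univ [Fintype α] {E : Finset (Finset α)} {i j : α} :
    j ∈ compOf E Finset.univ i ↔ Relation.ReflTransGen (Linked E) i j := by
  simp [compOf]

/-- A set that every hyperlink either lies in or misses is a union of components. -/
lemma mem_iff_mem_of_reflTransGen {E : Finset (Finset α)} {C : Finset α}
    (hC : ∀ e ∈ E, e ⊆ C ∨ Disjoint e C) {a b : α}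
    (h : Relation.ReflTransGen (Linked E) a b) : a ∈ C ↔ b ∈ C := by
  induction h with
  | refl => rfl
  | tail _ hbc ih =>
    obtain ⟨e, he, hb, hc⟩ := hbc
    rw [ih]
    rcases hC e he with hs | hd
    · exact iff_of_true (hs hb) (hs hc)
    · exact iff_of_false (Finset.disjoint_left.mp hd hb) (Finset.disjoint_left.mp hd hc)

/-- If some union of components separates two of the players `0, 1, 2`, the worth vanishes. -/
lemma restrictedWorth_exV_eq_zero {E : Finset (Finset (Fin 6))} (C : Finset (Fin 6))
    (hC : ∀ e ∈ E, e ⊆ C ∨ Disjoint e C)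
    (hsep : ¬ ((0 ∈ C ↔ 1 ∈ C) ∧ (0 ∈ C ↔ 2 ∈ C))) :
    restrictedWorth exV E Finset.univ = 0 := by
  refine Finset.sum_eq_zero fun T hT => if_neg fun hsub => hsep ?_
  obtain ⟨i, -, rfl⟩ := mem_components.mp hT
  have key (k : Fin 6) (hk : k ∈ ({0, 1, 2} : Finset (Fin 6))) : i ∈ C ↔ k ∈ C :=
    mem_iff_mem_of_reflTransGen hC (mem_compOf_univ.mp (hsub hk))
  exact ⟨(key 0 (by simp)).symm.trans (key 1 (by simp)),
    (key 0 (by simp)).symm.trans (key 2 (by simp))⟩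

lemma restrictedWorth_exV_of_ssubset {E : Finset (Finset (Fin 6))} (hE : E ⊂ exH) :
    restrictedWorth exV E Finset.univ = 0 := by
  obtain ⟨e, he, hEe⟩ := Finset.ssubset_iff_exists_subset_erase.mp hE
  have of_erase (C : Finset (Fin 6)) (hC : ∀ f ∈ exH.erase e, f ⊆ C ∨ Disjoint f C)
      (hsep : ¬ ((0 ∈ C ↔ 1 ∈ C) ∧ (0 ∈ C ↔ 2 ∈ C))) :
      restrictedWorth exV E Finset.univ = 0 :=
    restrictedWorth_exV_eq_zero C (fun f hf => hC f (hEe hf)) hsep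
  simp only [exH, Finset.mem_insert, Finset.mem_singleton] at he
  rcases he with rfl | rfl | rfl | rfl
  · exact of_erase {0} (by decide) (by decide)
  · exact of_erase {1} (by decide) (by decide)
  · exact of_erase {2} (by decide) (by decide)
  · exact of_erase {0, 3} (by decide) (by decide)

lemma restrictedWorth_exV_exH : restrictedWorth exV exH Finset.univ = 1 := by
  have : Std.Symm (Linked exH) := ⟨fun _ _ ⟨e, he, ha, hb⟩ => ⟨e, he, hb, ha⟩⟩
  have link {a b : Fin 6} (e : Finset (Fin 6)) (h : e ∈ exH ∧ a ∈ e ∧ b ∈ e) : Linked exH a b :=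
    ⟨e, h⟩
  have h03 : Linked exH 0 3 := link {0, 3} (by decide)
  have h14 : Linked exH 1 4 := link {1, 4} (by decide)
  have h25 : Linked exH 2 5 := link {2, 5} (by decide)
  have h43 : Linked exH 4 3 := link {3, 4, 5} (by decide)
  have h53 : Linked exH 5 3 := link {3, 4, 5} (by decide)
  have to_three (i : Fin 6) : Relation.ReflTransGen (Linked exH) i 3 := by
    fin_cases i
    · exact .single h03
    · exact .head h14 (.single h43)
    · exact .head h25 (.single h53)
    · exact .refl
    · exact .single h43
    · exact .single h53
  have conn (i j : Fin 6) : Relation.ReflTransGen (Linked exH) i j :=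
    (to_three i).trans (Relation.ReflTransGen.stdSymm.symm _ _ (to_three j))
  have hcomp (i : Fin 6) : compOf exH Finset.univ i = Finset.univ :=
    Finset.eq_univ_of_forall fun j => mem_compOf_univ.mpr (conn i j)
  have hcomps : components exH Finset.univ = {Finset.univ} := by
    ext T
    simp [mem_components, hcomp, eq_comm]
  rw [restrictedWorth, hcomps, Finset.sum_singleton]
  exact if_pos (Finset.subset_univ _)

lemma confGame_exV_exH_univ : confGame exV exH Finset.univ = 1 := by
  have himage : (Finset.univ : Finset {e // e ∈ exH}).image Subtype.val = exH := by
    ext; simp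
  rw [confGame, himage, restrictedWorth_exV_exH]

lemma confGame_exV_exH_of_ne_univ (F : Finset {e // e ∈ exH}) (hF : F ≠ Finset.univ) :
    confGame exV exH F = 0 := by
  refine restrictedWorth_exV_of_ssubset (Finset.ssubset_iff_subset_ne.mpr ⟨?_, fun h => ?_⟩)
  · intro e he
    obtain ⟨f, -, rfl⟩ := Finset.mem_image.mp he
    exact f.2
  · refine hF (Finset.eq_univ_of_forall fun e => ?_)
    obtain ⟨f, hf, hfe⟩ := Finset.mem_image.mp (h.ge e.2)
    rwa [← Subtype.ext hfe]

lemma positionValue_exV_exH (i : Fin 6) :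
    positionValue exV exH i = (∑ e ∈ exH.filter (fun e => i ∈ e), (e.card : ℝ)⁻¹) / 4 := by
  have hcard : Fintype.card {e // e ∈ exH} = 4 := by
    rw [Fintype.card_coe]; decide
  simp only [positionValue, hcard,
    shapley_unanimity_univ confGame_exV_exH_univ confGame_exV_exH_of_ne_univ]
  rw [Finset.sum_filter, Finset.sum_filter, Finset.sum_div,
    Finset.sum_attach exH fun e => if i ∈ e then (e.card : ℝ)⁻¹ * ((4 : ℕ) : ℝ)⁻¹ else 0]
  exact Finset.sum_congr rfl fun e _ => by split_ifs <;> simp [div_eq_mul_inv]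

lemma positionValue_exV_of_ssubset {A : Finset (Finset (Fin 6))} (hA : A ⊂ exH) (i : Fin 6) :
    positionValue exV A i = 0 := by
  have hzero (F : Finset {e // e ∈ A}) : confGame exV A F = 0 := by
    refine restrictedWorth_exV_of_ssubset (lt_of_le_of_lt ?_ hA)
    intro e he
    obtain ⟨f, -, rfl⟩ := Finset.mem_image.mp he
    exact f.2
  simp [positionValue, shapley, marginal, hzero]

/-- Example 1: the position value of `(N, u_{{1,2,3}}, H)` is `1/8` for players `1,2,3`
and `5/24` for players `4,5,6`, while it vanishes identically on every proper
subset of hyperlinks. -/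
theorem example_one_position_value :
    (positionValue exV exH 0 = 1 / 8 ∧ positionValue exV exH 1 = 1 / 8 ∧
      positionValue exV exH 2 = 1 / 8 ∧ positionValue exV exH 3 = 5 / 24 ∧
      positionValue exV exH 4 = 5 / 24 ∧ positionValue exV exH 5 = 5 / 24)
    ∧ ∀ A : Finset (Finset (Fin 6)), A ⊂ exH → ∀ i : Fin 6, positionValue exV A i = 0 := by
  have pair (i : Fin 6) (e : Finset (Fin 6)) (he : e.card = 2)
      (h : exH.filter (fun e => i ∈ e) = {e}) : positionValue exV exH i = 1 / 8 := by
    rw [positionValue_exV_exH, h, Finset.sum_singleton, he]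
    norm_num
  have pair_triple (i : Fin 6) (e f : Finset (Fin 6)) (he : e.card = 2) (hf : f.card = 3)
      (h : exH.filter (fun e => i ∈ e) = {e, f}) : positionValue exV exH i = 5 / 24 := by
    rw [positionValue_exV_exH, h, Finset.sum_pair (by rintro rfl; omega), he, hf]
    norm_num
  exact ⟨⟨pair 0 {0, 3} rfl (by decide), pair 1 {1, 4} rfl (by decide),
    pair 2 {2, 5} rfl (by decide), pair_triple 3 {0, 3} {3, 4, 5} rfl rfl (by decide),
    pair_triple 4 {1, 4} {3, 4, 5} rfl rfl (by decide),
    pair_triple 5 {2, 5} {3, 4, 5} rfl rfl (by decide)⟩,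
    fun _ hA i => positionValue_exV_of_ssubset hA i⟩

end HGGame
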